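/- arXiv:2401.14580 — 6 statements merged into one kernel-verified Lean document; each statement's English description precedes it below -/
import Mathlib

section
/- Let N, K be natural numbers with K ≥ 3. Let y : Fin N → Option (Fin K) be a partial labeling such that every class is represented, i.e., for every k there exists i with y i = some k. Let A be a symmetric N×N real matrix with entries in {0,1} and zero diagonal (the graph adjacency), and let C be the N×K connection matrix with C i k = 1 if y i = some k, C i k = -1 if y i = some k' with k' ≠ k, and C i k = 0 if y i = none. Form the (N+K)×(N+K) augmented adjacency with self-loops M whose blocks are [[A + I_N, C], [Cᵀ, I_K]], let D be the diagonal matrix with D_ii = Σ_j |M_ij|, and set Â_c = D⁻¹ M. If h ∈ ℝ^{N+K} satisfies Â_c h = h and the first N coordinates of h are all equal to a common constant c, then h = 0. In particular, no nonzero state that is constant on the original N nodes is a stationary point of the discretized UYGCN dynamics. -/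
open Matrix

/-- If every absolute row sum of `M` is nonzero, a fixed point of the row-normalized matrix satisfies
`M h = D h`. -/
theorem sum_mul_eq_of_normalized_fixed {ι : Type*} [Fintype ι] [DecidableEq ι]
    (M : Matrix ι ι ℝ) (hM : ∀ i, ∑ j, |M i j| ≠ 0) (h : ι → ℝ)
    (hfix : ((Matrix.diagonal fun i => ∑ j, |M i j|)⁻¹ * M).mulVec h = h) (i : ι) :
    ∑ j, M i j * h j = (∑ j, |M i j|) * h i := by
  have hdet : IsUnit (Matrix.diagonal fun i => ∑ j, |M i j|).det := by
    rw [Matrix.det_diagonal]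
    exact (Finset.prod_ne_zero_iff.mpr fun i _ => hM i).isUnit
  have hmul := congrArg (fun v => (Matrix.diagonal fun i => ∑ j, |M i j|).mulVec v) hfix
  simp only [Matrix.mulVec_mulVec, Matrix.mul_nonsing_inv_cancel_left _ _ hdet] at hmul
  have hi := congrFun hmul i
  rwa [Matrix.mulVec_diagonal] at hi

/-- A signed class-indicator row paired with `v` gives `2 v k₀ - ∑ v`. -/
theorem sum_ite_one_neg_one_mul {κ : Type*} [Fintype κ] [DecidableEq κ] (k₀ : κ) (v : κ → ℝ) :
    ∑ k, (if k₀ = k then (1 : ℝ) else -1) * v k = 2 * v k₀ - ∑ k, v k := by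
  have hsplit : ∀ k, (if k₀ = k then (1 : ℝ) else -1) * v k =
      2 * (if k₀ = k then v k else 0) - v k := by
    intro k
    split_ifs <;> ring
  simp [hsplit, Finset.sum_sub_distrib]

/-- No nonzero state that is constant on the original `N` nodes is a stationary
point of the discretized UYGCN dynamics `h ↦ D⁻¹ M h`, where `M` is the
collapsing-node augmented adjacency (with self-loops) and `D` the diagonal matrix
of absolute row sums. -/
theorem stmt_0 (N K : ℕ) (hK : 3 ≤ K)
    (y : Fin N → Option (Fin K))
    (hsurj : ∀ k : Fin K, ∃ i : Fin N, y i = some k)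
    (A : Matrix (Fin N) (Fin N) ℝ) (hAsymm : A.IsSymm)
    (hA01 : ∀ i j, A i j = 0 ∨ A i j = 1) (hAdiag : ∀ i, A i i = 0)
    (C : Matrix (Fin N) (Fin K) ℝ)
    (hC : ∀ i k, C i k =
      match y i with
      | none => 0
      | some k' => if k' = k then 1 else -1)
    (M : Matrix (Fin N ⊕ Fin K) (Fin N ⊕ Fin K) ℝ)
    (hM : M = Matrix.fromBlocks (A + 1) C Cᵀ 1)
    (D : Matrix (Fin N ⊕ Fin K) (Fin N ⊕ Fin K) ℝ)
    (hD : D = Matrix.diagonal (fun i => ∑ j, |M i j|))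
    (h : Fin N ⊕ Fin K → ℝ)
    (hfix : (D⁻¹ * M).mulVec h = h)
    (c : ℝ) (hconst : ∀ i : Fin N, h (Sum.inl i) = c) :
    h = 0 := by
  subst hM hD
  have hpos : ∀ i, ∑ j, |Matrix.fromBlocks (A + 1) C Cᵀ 1 i j| ≠ 0 := by
    intro i
    refine (Finset.sum_pos' (fun j _ => abs_nonneg _) ⟨i, Finset.mem_univ i, ?_⟩).ne'
    cases i <;> simp [hAdiag]
  have hrow := sum_mul_eq_of_normalized_fixed _ hpos h hfix
  have hnode : ∀ i, ∑ k, C i k * h (Sum.inr k) = (∑ k, |C i k|) * c := by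
    intro i
    have hi := hrow (Sum.inl i)
    simp only [Fintype.sum_sum_type, Matrix.fromBlocks_apply₁₁, Matrix.fromBlocks_apply₁₂,
      hconst, ← Finset.sum_mul] at hi
    have habs : ∀ j, |(A + 1) i j| = (A + 1) i j := by
      intro j
      apply abs_of_nonneg
      rw [Matrix.add_apply, Matrix.one_apply]
      rcases hA01 i j with hij | hij <;> rw [hij] <;> split_ifs <;> norm_num
    simp only [habs] at hi
    linarith
  have hclass : ∀ k, (∑ i, C i k) * c = (∑ i, |C i k|) * h (Sum.inr k) := by
    intro k
    have hk := hrow (Sum.inr k)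
    simp only [Fintype.sum_sum_type, Matrix.fromBlocks_apply₂₁, Matrix.fromBlocks_apply₂₂,
      hconst, ← Finset.sum_mul, Matrix.transpose_apply] at hk
    simp only [Matrix.one_apply, ite_mul, one_mul, zero_mul, Finset.sum_ite_eq, Finset.mem_univ,
      if_true, apply_ite abs, abs_one, abs_zero] at hk
    linarith
  have hlabel : ∀ k, 2 * h (Sum.inr k) - ∑ l, h (Sum.inr l) = K * c := by
    intro k
    obtain ⟨i, hi⟩ := hsurj k
    have hn := hnode i
    simp only [hC, hi, sum_ite_one_neg_one_mul k fun l => h (Sum.inr l), apply_ite abs, abs_one,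
      abs_neg, ite_self] at hn
    simpa using hn
  have hKpos : 0 < K := by omega
  have hK' : (3 : ℝ) ≤ K := by exact_mod_cast hK
  obtain ⟨t, ht⟩ : ∃ t, ∀ k, h (Sum.inr k) = t :=
    ⟨h (Sum.inr ⟨0, hKpos⟩), fun k => by linarith [hlabel k, hlabel ⟨0, hKpos⟩]⟩
  have hlin : (2 - K) * t = K * c := by
    have h0 := hlabel ⟨0, hKpos⟩
    simp only [ht, Finset.sum_const, Finset.card_univ, Fintype.card_fin, nsmul_eq_mul] at h0
    linarith
  have hrowsum : ∀ i, K * ∑ k, C i k = (2 - K) * ∑ k, |C i k| := by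
    intro i
    cases hi : y i with
    | none => simp [hC, hi]
    | some k =>
      have hs := sum_ite_one_neg_one_mul k fun _ => (1 : ℝ)
      simp only [mul_one] at hs
      simp only [hC, hi, hs, apply_ite abs, abs_one, abs_neg, ite_self]
      simp
      ring
  have htotal : K * ∑ i, ∑ k, C i k = (2 - K) * ∑ i, ∑ k, |C i k| := by
    simp only [Finset.mul_sum (s := (Finset.univ : Finset (Fin N))), hrowsum]
  have hbalance : (∑ i, ∑ k, C i k) * c = (∑ i, ∑ k, |C i k|) * t := by
    have hswap : ∑ i, ∑ k, C i k = ∑ k, ∑ i, C i k := Finset.sum_comm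
    rw [hswap, Finset.sum_comm (f := fun i k => |C i k|), Finset.sum_mul, Finset.sum_mul]
    exact Finset.sum_congr rfl fun k _ => by rw [hclass, ht]
  have hmass : 0 < ∑ i, ∑ k, |C i k| := by
    obtain ⟨i, hi⟩ := hsurj ⟨0, hKpos⟩
    refine Finset.sum_pos' (fun i _ => Finset.sum_nonneg fun k _ => abs_nonneg _)
      ⟨i, Finset.mem_univ i, Finset.sum_pos' (fun k _ => abs_nonneg _)
        ⟨⟨0, hKpos⟩, Finset.mem_univ _, ?_⟩⟩
    simp [hC, hi]
  have hdual : (2 - K) * c = K * t := by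
    apply mul_left_cancel₀ hmass.ne'
    linear_combination K * hbalance - c * htotal
  have hc : c = 0 := by
    have hprod : (4 - 4 * (K : ℝ)) * c = 0 := by
      linear_combination (2 - (K : ℝ)) * hdual + K * hlin
    exact (mul_eq_zero.mp hprod).resolve_left (by linarith)
  have ht0 : t = 0 := by
    rw [hc, mul_zero] at hdual
    exact (mul_eq_zero.mp hdual.symm).resolve_left (by linarith)
  funext x
  cases x with
  | inl i => simp [hconst, hc]
  | inr k => simp [ht, ht0]
end

section
/- Let n be a positive natural number, let L be an n×n real matrix, let M ≥ 0 be a real constant such that x ⬝ L x ≥ −M·‖x‖² for all x ∈ ℝⁿ, and let δ > 0. Suppose h : ℝ → ℝⁿ is differentiable and satisfies, componentwise, h_i'(t) = −(L h(t))_i + δ·h_i(t)·(1 − h_i(t)²) for all t. Then for every t ≥ 0, ‖h(t)‖² ≤ max(‖h(0)‖², n·(1 + M/δ)). In particular the trajectory of the graph diffusion with double-well potential remains uniformly bounded. -/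
open Matrix

/-- A differentiable function whose derivative is negative wherever its value exceeds `K` stays
below the maximum of its initial value and `K`. -/
lemma le_max_of_deriv_neg_of_lt {f f' : ℝ → ℝ} {a K : ℝ}
    (hf : ∀ t, HasDerivAt f (f' t) t) (hneg : ∀ t, K < f t → f' t < 0) {t : ℝ} (ht : a ≤ t) :
    f t ≤ max (f a) K := by
  refine le_of_forall_pos_le_add fun ε hε => ?_
  refine image_le_of_deriv_right_lt_deriv_boundary (B := fun _ => max (f a) K + ε)
    (B' := fun _ => 0) (a := a) (b := t)
    (fun s _ => (hf s).continuousAt.continuousWithinAt) (fun s _ => (hf s).hasDerivWithinAt)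
    (by linarith [le_max_left (f a) K]) (fun s => hasDerivAt_const s _)
    (fun s _ hs => hneg s ?_) ⟨ht, le_rfl⟩
  linarith [le_max_right (f a) K]

/-- The double-well vector field points strictly inwards outside the ball of squared radius
`n * (1 + M / δ)`. -/
lemma sum_two_mul_doubleWell_neg {n : ℕ} (hn : 0 < n) {L : Matrix (Fin n) (Fin n) ℝ} {M δ : ℝ}
    (hM : 0 ≤ M) (hδ : 0 < δ) {x : Fin n → ℝ}
    (hL : x ⬝ᵥ L.mulVec x ≥ -M * ∑ i, x i ^ 2)
    (hx : (n : ℝ) * (1 + M / δ) < ∑ i, x i ^ 2) :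
    ∑ i, 2 * x i * (-(L.mulVec x) i + δ * x i * (1 - x i ^ 2)) < 0 := by
  have hn' : (0 : ℝ) < n := Nat.cast_pos.2 hn
  have hcs : (∑ i, x i ^ 2) ^ 2 ≤ n * ∑ i, x i ^ 4 := by
    have := sq_sum_le_card_mul_sum_sq (s := Finset.univ) (f := fun i => x i ^ 2)
    simpa [← pow_mul] using this
  have hsplit : ∑ i, 2 * x i * (-(L.mulVec x) i + δ * x i * (1 - x i ^ 2)) =
      -2 * (x ⬝ᵥ L.mulVec x) + 2 * δ * ∑ i, x i ^ 2 - 2 * δ * ∑ i, x i ^ 4 := by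
    simp only [dotProduct, Finset.mul_sum, ← Finset.sum_add_distrib, ← Finset.sum_sub_distrib]
    exact Finset.sum_congr rfl fun i _ => by ring
  rw [hsplit]
  set V := ∑ i, x i ^ 2
  have hV : 0 < V := lt_of_le_of_lt (by positivity) hx
  have hδV : n * (δ + M) < δ * V := by
    calc n * (δ + M) = δ * (n * (1 + M / δ)) := by field_simp
      _ < δ * V := mul_lt_mul_of_pos_left hx hδ
  have hquartic : (δ + M) * V < δ * ∑ i, x i ^ 4 := by
    refine lt_of_mul_lt_mul_left ?_ hn'.le
    calc n * ((δ + M) * V) = n * (δ + M) * V := by ring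
      _ < δ * V * V := mul_lt_mul_of_pos_right hδV hV
      _ = δ * V ^ 2 := by ring
      _ ≤ δ * (n * ∑ i, x i ^ 4) := mul_le_mul_of_nonneg_left hcs hδ.le
      _ = n * (δ * ∑ i, x i ^ 4) := by ring
  linarith

/-- Boundedness of the graph diffusion with double-well potential: if the linear
part `L` satisfies `x ⬝ L x ≥ −M‖x‖²` and `h` solves
`h_i' = −(L h)_i + δ h_i (1 − h_i²)`, then `‖h(t)‖² ≤ max(‖h(0)‖², n(1 + M/δ))`
for all `t ≥ 0`. -/
theorem stmt_3 (n : ℕ) (hn : 0 < n) (L : Matrix (Fin n) (Fin n) ℝ)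
    (M : ℝ) (hM : 0 ≤ M)
    (hLbd : ∀ x : Fin n → ℝ, x ⬝ᵥ L.mulVec x ≥ -M * ∑ i, x i ^ 2)
    (δ : ℝ) (hδ : 0 < δ)
    (h : ℝ → Fin n → ℝ)
    (hode : ∀ (t : ℝ) (i : Fin n),
      HasDerivAt (fun s => h s i)
        (-(L.mulVec (h t)) i + δ * h t i * (1 - h t i ^ 2)) t) :
    ∀ t : ℝ, 0 ≤ t →
      ∑ i, h t i ^ 2 ≤ max (∑ i, h 0 i ^ 2) ((n : ℝ) * (1 + M / δ)) := by
  intro t ht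
  have hderiv : ∀ s, HasDerivAt (fun s => ∑ i, h s i ^ 2)
      (∑ i, 2 * h s i * (-(L.mulVec (h s)) i + δ * h s i * (1 - h s i ^ 2))) s := fun s =>
    HasDerivAt.fun_sum fun i _ => by simpa using (hode s i).fun_pow 2
  exact le_max_of_deriv_neg_of_lt hderiv
    (fun s hs => sum_two_mul_doubleWell_neg hn hM hδ (hLbd (h s)) hs) ht
end

section
/- Let n, d, r be natural numbers, α, β ≥ 0 real constants, σ : ℝ → ℝ a differentiable function with |σ'(x)| ≤ α for all x, W_0, …, W_{r−1} d×d real matrices each of ℓ²-operator norm at most β, and A an n×n real matrix. For an input X : Fin n → ℝ^d define the layers Φ^{(0)}(X) = X and Φ^{(ℓ+1)}(X)_i = σ∘(Σ_j A_{ij}·W_ℓ Φ^{(ℓ)}(X)_j) (σ applied entrywise to the d-dimensional vector). Then for all nodes i, s and every input X, the map X ↦ Φ^{(r)}(X)_i is differentiable and the operator norm of its partial Jacobian with respect to the feature vector x_s of node s satisfies ‖∂Φ^{(r)}(X)_i/∂x_s‖ ≤ (2αβ)^r · (Σ_{ℓ=0}^{r} |A|^ℓ)_{is}, where |A| denotes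 the entrywise absolute value of A. -/
open Matrix

theorem EuclideanSpace.norm_le_mul_norm_of_apply_eq_mul {d : ℕ} {α : ℝ} (hα : 0 ≤ α) (c : Fin d → ℝ) (hc : ∀ k, |c k| ≤ α)
    (u w : EuclideanSpace ℝ (Fin d)) (hw : ∀ k, w k = c k * u k) : ‖w‖ ≤ α * ‖u‖ := by
  refine le_of_sq_le_sq ?_ (by positivity)
  rw [mul_pow, EuclideanSpace.norm_sq_eq, EuclideanSpace.norm_sq_eq, Finset.mul_sum]
  refine Finset.sum_le_sum fun k _ => ?_
  rw [hw k, norm_mul, mul_pow]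
  gcongr
  exact hc k

/-- Applying a scalar function with derivative bounded by `α` entrywise multiplies the norm of
the derivative by at most `α`. -/
theorem differentiableAt_entrywise_and_norm_fderiv_le {E : Type*} [NormedAddCommGroup E]
    [NormedSpace ℝ E] {d : ℕ} {α : ℝ} (hα : 0 ≤ α) {σ : ℝ → ℝ} (hσ : Differentiable ℝ σ)
    (hσ' : ∀ x, |deriv σ x| ≤ α) {u g : E → EuclideanSpace ℝ (Fin d)}
    (hg : ∀ x k, g x k = σ (u x k)) {x : E} (hu : DifferentiableAt ℝ u x) :
    DifferentiableAt ℝ g x ∧ ‖fderiv ℝ g x‖ ≤ α * ‖fderiv ℝ u x‖ := by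
  have huk (k : Fin d) : HasFDerivAt (fun y => u y k)
      ((EuclideanSpace.proj k : EuclideanSpace ℝ (Fin d) →L[ℝ] ℝ) ∘L fderiv ℝ u x) x :=
    (EuclideanSpace.proj k : EuclideanSpace ℝ (Fin d) →L[ℝ] ℝ).hasFDerivAt.comp x hu.hasFDerivAt
  have hgk (k : Fin d) : HasFDerivAt (fun y => g y k) (deriv σ (u x k) •
      ((EuclideanSpace.proj k : EuclideanSpace ℝ (Fin d) →L[ℝ] ℝ) ∘L fderiv ℝ u x)) x := by
    simp only [hg]
    exact (hσ (u x k)).hasDerivAt.comp_hasFDerivAt x (huk k)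
  have hd : DifferentiableAt ℝ g x :=
    differentiableAt_euclidean.2 fun k => (hgk k).differentiableAt
  refine ⟨hd, ContinuousLinearMap.opNorm_le_bound _ (by positivity) fun v => ?_⟩
  have key (k : Fin d) : fderiv ℝ g x v k = deriv σ (u x k) * fderiv ℝ u x v k := by
    have h := ((EuclideanSpace.proj k : EuclideanSpace ℝ (Fin d) →L[ℝ] ℝ).hasFDerivAt.comp x
      hd.hasFDerivAt).unique (hgk k)
    simpa using congrArg (fun L => L v) h
  calc ‖fderiv ℝ g x v‖ ≤ α * ‖fderiv ℝ u x v‖ :=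
        EuclideanSpace.norm_le_mul_norm_of_apply_eq_mul hα _ (fun k => hσ' (u x k)) _ _ key
    _ ≤ α * (‖fderiv ℝ u x‖ * ‖v‖) := by gcongr; exact (fderiv ℝ u x).le_opNorm v
    _ = α * ‖fderiv ℝ u x‖ * ‖v‖ := by ring

/-- A weighted sum of linear images of differentiable maps is differentiable, with the expected
bound on its derivative. -/
theorem differentiableAt_sum_smul_and_norm_fderiv_le {E F G ι : Type*} [NormedAddCommGroup E]
    [NormedSpace ℝ E] [NormedAddCommGroup F] [NormedSpace ℝ F] [NormedAddCommGroup G]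
    [NormedSpace ℝ G] [Fintype ι] (a : ι → ℝ) (L : F →L[ℝ] G) {f : ι → E → F} {x : E}
    (hf : ∀ j, DifferentiableAt ℝ (f j) x) :
    DifferentiableAt ℝ (fun y => ∑ j, a j • L (f j y)) x ∧
      ‖fderiv ℝ (fun y => ∑ j, a j • L (f j y)) x‖ ≤
        ∑ j, |a j| * (‖L‖ * ‖fderiv ℝ (f j) x‖) := by
  have h : HasFDerivAt (fun y => ∑ j, a j • L (f j y)) (∑ j, a j • (L ∘L fderiv ℝ (f j) x)) x :=
    HasFDerivAt.fun_sum fun j _ =>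
      (L.hasFDerivAt.comp x (hf j).hasFDerivAt).const_smul (a j)
  refine ⟨h.differentiableAt, ?_⟩
  rw [h.fderiv]
  refine (norm_sum_le _ _).trans (Finset.sum_le_sum fun j _ => ?_)
  rw [norm_smul, Real.norm_eq_abs]
  gcongr
  exact L.opNorm_comp_le _

theorem pow_map_abs_nonneg {n : ℕ} (A : Matrix (Fin n) (Fin n) ℝ) (ℓ : ℕ) (i s : Fin n) :
    0 ≤ ((A.map fun a => |a|) ^ ℓ) i s := by
  induction ℓ generalizing i s with
  | zero => rw [pow_zero, Matrix.one_apply]; split_ifs <;> norm_num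
  | succ ℓ ih =>
    rw [pow_succ, Matrix.mul_apply]
    exact Finset.sum_nonneg fun j _ => mul_nonneg (ih i j) (abs_nonneg _)

theorem norm_fderiv_update_apply_le {n : ℕ} {E : Type*} [NormedAddCommGroup E] [NormedSpace ℝ E]
    (X : Fin n → E) (i s : Fin n) (x : E) :
    ‖fderiv ℝ (fun xs => Function.update X s xs i) x‖ ≤ (1 : Matrix (Fin n) (Fin n) ℝ) i s := by
  by_cases h : i = s
  · subst h
    simpa using ContinuousLinearMap.norm_id_le (𝕜 := ℝ) (E := E)
  · simp [Function.update_of_ne h, Matrix.one_apply_ne h]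

/-- Over-squashing sensitivity bound: for the `r`-layer message-passing network
`Φ^{(0)}(X) = X`, `Φ^{(ℓ+1)}(X)_i = σ(Σ_j A_{ij} W_ℓ Φ^{(ℓ)}(X)_j)` (with `σ` applied
entrywise), if `|σ'| ≤ α` and each `W_ℓ` has ℓ²-operator norm at most `β`, then the
map `X ↦ Φ^{(r)}(X)_i` is differentiable and the ℓ²-operator norm of its partial
Jacobian with respect to `x_s` is at most `(2αβ)^r (Σ_{ℓ=0}^r |A|^ℓ)_{is}`. -/
theorem stmt_6 (n d r : ℕ) (α β : ℝ) (hα : 0 ≤ α) (hβ : 0 ≤ β)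
    (σ : ℝ → ℝ) (hσ : Differentiable ℝ σ) (hσ' : ∀ x : ℝ, |deriv σ x| ≤ α)
    (W : ℕ → Matrix (Fin d) (Fin d) ℝ)
    (hW : ∀ ℓ < r, ‖Matrix.toEuclideanCLM (𝕜 := ℝ) (W ℓ)‖ ≤ β)
    (A : Matrix (Fin n) (Fin n) ℝ)
    (Φ : ℕ → (Fin n → EuclideanSpace ℝ (Fin d)) → Fin n → EuclideanSpace ℝ (Fin d))
    (hΦ0 : ∀ X, Φ 0 X = X)
    (hΦ : ∀ (ℓ : ℕ) (X : Fin n → EuclideanSpace ℝ (Fin d)) (i : Fin n) (k : Fin d),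
      Φ (ℓ + 1) X i k =
        σ (∑ j, A i j * Matrix.toEuclideanCLM (𝕜 := ℝ) (W ℓ) (Φ ℓ X j) k)) :
    ∀ (i s : Fin n),
      Differentiable ℝ (fun X => Φ r X i) ∧
      ∀ X : Fin n → EuclideanSpace ℝ (Fin d),
        ‖fderiv ℝ (fun xs => Φ r (Function.update X s xs) i) (X s)‖ ≤
          (2 * α * β) ^ r *
            (∑ ℓ ∈ Finset.range (r + 1), (A.map fun a => |a|) ^ ℓ) i s := by
  have hcomp (ℓ : ℕ) (Y : Fin n → EuclideanSpace ℝ (Fin d)) (i : Fin n) (k : Fin d) :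
      Φ (ℓ + 1) Y i k =
        σ ((∑ j, A i j • Matrix.toEuclideanCLM (𝕜 := ℝ) (W ℓ) (Φ ℓ Y j)) k) := by
    simp [hΦ]
  have hdiff (ℓ : ℕ) (i : Fin n) : Differentiable ℝ (fun X => Φ ℓ X i) := by
    induction ℓ generalizing i with
    | zero => simp only [hΦ0]; fun_prop
    | succ ℓ ih =>
      exact fun X => (differentiableAt_entrywise_and_norm_fderiv_le hα hσ hσ'
        (fun Y k => hcomp ℓ Y i k) (differentiableAt_sum_smul_and_norm_fderiv_le (A i)
          (Matrix.toEuclideanCLM (𝕜 := ℝ) (W ℓ)) fun j => ih j X).1).1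
  intro i s
  refine ⟨hdiff r i, fun X => ?_⟩
  have hpart (ℓ : ℕ) (j : Fin n) :
      DifferentiableAt ℝ (fun xs => Φ ℓ (Function.update X s xs) j) (X s) :=
    (hdiff ℓ j _).comp (X s) (hasFDerivAt_update X (X s)).differentiableAt
  have hbound (ℓ : ℕ) (hℓ : ℓ ≤ r) (i : Fin n) :
      ‖fderiv ℝ (fun xs => Φ ℓ (Function.update X s xs) i) (X s)‖ ≤
        (α * β) ^ ℓ * ((A.map fun a => |a|) ^ ℓ) i s := by
    induction ℓ generalizing i with
    | zero => simpa [hΦ0] using norm_fderiv_update_apply_le X i s (X s)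
    | succ ℓ ih =>
      obtain ⟨hs, hs'⟩ := differentiableAt_sum_smul_and_norm_fderiv_le (A i)
        (Matrix.toEuclideanCLM (𝕜 := ℝ) (W ℓ)) (hpart ℓ)
      refine (differentiableAt_entrywise_and_norm_fderiv_le hα hσ hσ'
        (fun xs k => hcomp ℓ (Function.update X s xs) i k) hs).2.trans ?_
      calc _ ≤ α * ∑ j, |A i j| * (β * ((α * β) ^ ℓ * ((A.map fun a => |a|) ^ ℓ) j s)) := by
            refine mul_le_mul_of_nonneg_left (hs'.trans ?_) hα
            gcongr with j
            · exact hW ℓ hℓ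
            · exact ih (by omega) j
        _ = _ := by
            rw [pow_succ' (A.map _), Matrix.mul_apply, Finset.mul_sum, Finset.mul_sum]
            refine Finset.sum_congr rfl fun j _ => ?_
            rw [Matrix.map_apply]
            ring
  refine (hbound r le_rfl i).trans ?_
  have hαβ : 0 ≤ α * β := mul_nonneg hα hβ
  rw [Matrix.sum_apply]
  refine mul_le_mul (pow_le_pow_left₀ hαβ (by linarith) r) ?_ (pow_map_abs_nonneg A r i s)
    (pow_nonneg (by linarith) r)
  exact Finset.single_le_sum (f := fun ℓ => ((A.map fun a => |a|) ^ ℓ) i s)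
    (fun ℓ _ => pow_map_abs_nonneg A ℓ i s) (Finset.self_mem_range_succ r)
end

section
/- Let E be an n×m real matrix and w : Fin m → ℝ, and let L = E · diag(w) · Eᵀ, which is a symmetric n×n real matrix. Then the number of negative eigenvalues of L (counted with multiplicity) is at most the number of indices e with w(e) < 0. -/
open Matrix

/-- If every diagonal entry of `diagonal d = F * diagonal w * Fᵀ` is negative, then `w` has at least
as many negative entries as `d` has entries. -/
theorem card_le_card_neg_of_diagonal_eq {ι κ : Type*} [Fintype ι] [DecidableEq ι] [Fintype κ]
    [DecidableEq κ] {d : ι → ℝ} {w : κ → ℝ} {F : Matrix ι κ ℝ}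
    (hF : diagonal d = F * diagonal w * Fᵀ) (hd : ∀ i, d i < 0) :
    Fintype.card ι ≤ (Finset.univ.filter (fun e => w e < 0)).card := by
  rw [← Fintype.card_subtype, ← Module.finrank_fintype_fun_eq_card ℝ,
    ← Module.finrank_fintype_fun_eq_card (η := {e // w e < 0}) ℝ]
  let T := (Fᵀ.submatrix (Subtype.val : {e // w e < 0} → κ) id).mulVecLin
  refine LinearMap.finrank_le_finrank_of_injective (f := T) ?_
  rw [injective_iff_map_eq_zero]
  intro c hc
  have hzero (e : κ) (he : w e < 0) : (Fᵀ *ᵥ c) e = 0 := congrFun hc ⟨e, he⟩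
  have hquad : ∑ i, d i * c i ^ 2 = ∑ e, w e * (Fᵀ *ᵥ c) e ^ 2 := by
    calc ∑ i, d i * c i ^ 2 = c ⬝ᵥ (diagonal d *ᵥ c) := by
          simp only [dotProduct, mulVec_diagonal]
          exact Finset.sum_congr rfl fun i _ => by ring
      _ = (Fᵀ *ᵥ c) ⬝ᵥ (diagonal w *ᵥ (Fᵀ *ᵥ c)) := by
          rw [hF, ← mulVec_mulVec, ← mulVec_mulVec, dotProduct_mulVec, mulVec_transpose]
      _ = _ := by
          simp only [dotProduct, mulVec_diagonal]
          exact Finset.sum_congr rfl fun i _ => by ring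
  have hnonneg : 0 ≤ ∑ e, w e * (Fᵀ *ᵥ c) e ^ 2 := by
    refine Finset.sum_nonneg fun e _ => ?_
    rcases lt_or_ge (w e) 0 with he | he
    · simp [hzero e he]
    · positivity
  have hnonpos : ∀ i ∈ Finset.univ, d i * c i ^ 2 ≤ 0 := fun i _ =>
    mul_nonpos_of_nonpos_of_nonneg (hd i).le (sq_nonneg _)
  have hsum : ∑ i, d i * c i ^ 2 = 0 :=
    le_antisymm (Finset.sum_nonpos hnonpos) (hquad ▸ hnonneg)
  funext i
  have hi := (Finset.sum_eq_zero_iff_of_nonpos hnonpos).1 hsum i (Finset.mem_univ i)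
  simpa [(hd i).ne] using hi

/-- Inertia bound for signed graph Laplacians: if `L = E · diag(w) · Eᵀ`, then the
number of negative eigenvalues of `L` (with multiplicity) is at most the number of
indices `e` with `w e < 0`. -/
theorem stmt_9 (n m : ℕ) (E : Matrix (Fin n) (Fin m) ℝ) (w : Fin m → ℝ)
    (L : Matrix (Fin n) (Fin n) ℝ) (hLdef : L = E * Matrix.diagonal w * Eᵀ)
    (hL : L.IsHermitian) :
    (Finset.univ.filter (fun i : Fin n => hL.eigenvalues i < 0)).card ≤
      (Finset.univ.filter (fun e : Fin m => w e < 0)).card := by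
  let U : Matrix (Fin n) (Fin n) ℝ := hL.eigenvectorUnitary
  have hdiag : diagonal hL.eigenvalues = Uᵀ * E * diagonal w * (Uᵀ * E)ᵀ := by
    have h := hL.conjStarAlgAut_star_eigenvectorUnitary
    rw [Unitary.conjStarAlgAut_star_apply] at h
    calc diagonal hL.eigenvalues = Uᵀ * L * U := h.symm
      _ = _ := by simp only [hLdef, transpose_mul, transpose_transpose, Matrix.mul_assoc]
  let s : {i // hL.eigenvalues i < 0} → Fin n := Subtype.val
  rw [← Fintype.card_subtype]
  refine card_le_card_neg_of_diagonal_eq (d := hL.eigenvalues ∘ s)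
    (F := (Uᵀ * E).submatrix s id) ?_ fun i => i.2
  rw [← submatrix_diagonal _ s Subtype.val_injective, hdiag]
  rfl
end

section
/- Let N, K be positive natural numbers, T a nonempty finite subset of the N original nodes, and y : T → Fin K a surjective labeling. Consider the signed graph on the N + K vertices (the N original nodes together with K collapsing nodes) whose weighted edges are: an arbitrary set of edges among the original nodes each with weight +1; for each v ∈ T and each class k, an edge between v and collapsing node k with weight +1 if y(v) = k and weight −1 otherwise; and an edge of weight −1 between every pair of distinct collapsing nodes. Let L_c be the signed graph Laplacian, L_c = Σ_{edges (u,v)} w_{uv} (e_u − e_v)(e_u − e_v)ᵀ. Then L_c is symmetric and the number of its negative eigenvalues (counted with multiplicity) is at most K(K−1)/2 + K(|T| − 1). -/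
open Matrix

/-- The signed rank-one Laplacian contribution `w·(e_u − e_v)(e_u − e_v)ᵀ` of an edge,
here for unit weight: `(e_u − e_v)(e_u − e_v)ᵀ`. -/
noncomputable def edgeLap {V : Type*} [DecidableEq V] (u v : V) : Matrix V V ℝ :=
  Matrix.vecMulVec
    (fun w => (if w = u then (1 : ℝ) else 0) - (if w = v then (1 : ℝ) else 0))
    (fun w => (if w = u then (1 : ℝ) else 0) - (if w = v then (1 : ℝ) else 0))

/-- The quadratic form of a real symmetric matrix in the coordinates of its eigenbasis. -/
theorem dotProduct_mulVec_eigenvectorUnitary {n : Type*} [Fintype n] [DecidableEq n]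
    {A : Matrix n n ℝ} (hA : A.IsHermitian) (c : n → ℝ) :
    ((hA.eigenvectorUnitary : Matrix n n ℝ) *ᵥ c) ⬝ᵥ
      (A *ᵥ ((hA.eigenvectorUnitary : Matrix n n ℝ) *ᵥ c)) =
        ∑ i, hA.eigenvalues i * c i ^ 2 := by
  have h := hA.conjStarAlgAut_star_eigenvectorUnitary
  rw [Unitary.conjStarAlgAut_star_apply, star_eq_conjTranspose,
    conjTranspose_eq_transpose_of_trivial] at h
  rw [dotProduct_comm, dotProduct_mulVec, ← mulVec_transpose, mulVec_mulVec, mulVec_mulVec,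
    h, dotProduct]
  refine Finset.sum_congr rfl fun i _ => ?_
  rw [mulVec_diagonal]
  simp only [Function.comp_apply, RCLike.ofReal_real_eq_id, id_eq]
  ring

/-- If the quadratic form of a real symmetric matrix is nonnegative on the common kernel of
finitely many linear forms, then the number of its negative eigenvalues is at most the number
of these forms. -/
theorem card_neg_eigenvalues_le {n J : Type*} [Fintype n] [DecidableEq n] [Fintype J]
    {A : Matrix n n ℝ} (hA : A.IsHermitian) (l : (n → ℝ) →ₗ[ℝ] (J → ℝ))
    (hl : ∀ x, l x = 0 → 0 ≤ x ⬝ᵥ (A *ᵥ x)) :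
    (Finset.univ.filter (fun i => hA.eigenvalues i < 0)).card ≤ Fintype.card J := by
  let extend : ({i // hA.eigenvalues i < 0} → ℝ) →ₗ[ℝ] (n → ℝ) :=
    Function.ExtendByZero.linearMap ℝ Subtype.val
  let f := l ∘ₗ (hA.eigenvectorUnitary : Matrix n n ℝ).mulVecLin ∘ₗ extend
  have hf : Function.Injective f := by
    rw [injective_iff_map_eq_zero]
    intro c hc
    have h0 := hl _ hc
    rw [LinearMap.comp_apply, mulVecLin_apply, dotProduct_mulVec_eigenvectorUnitary] at h0
    have hext (i : {i // hA.eigenvalues i < 0}) : extend c i = c i :=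
      Subtype.val_injective.extend_apply c (0 : n → ℝ) i
    have hnonpos : ∀ i ∈ Finset.univ, hA.eigenvalues i * extend c i ^ 2 ≤ 0 := by
      intro i _
      by_cases hi : hA.eigenvalues i < 0
      · exact mul_nonpos_of_nonpos_of_nonneg hi.le (sq_nonneg _)
      · have : extend c i = 0 :=
          Function.extend_apply' c (0 : n → ℝ) i fun ⟨j, hj⟩ => hi (hj ▸ j.2)
        simp [this]
    have hzero := (Finset.sum_eq_zero_iff_of_nonpos hnonpos).1
      (le_antisymm (Finset.sum_nonpos hnonpos) h0)
    ext i
    have hi := hzero i (Finset.mem_univ _)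
    rw [hext, mul_eq_zero, or_iff_right i.2.ne] at hi
    simpa using hi
  have := LinearMap.finrank_le_finrank_of_injective hf
  rwa [Module.finrank_fintype_fun_eq_card, Module.finrank_fintype_fun_eq_card,
    Fintype.card_subtype] at this

theorem edgeLap_isHermitian {V : Type*} [DecidableEq V] (u v : V) :
    (edgeLap u v).IsHermitian := by
  ext i j
  simp [edgeLap, vecMulVec_apply, mul_comm]

theorem dotProduct_edgeLap_mulVec {V : Type*} [Fintype V] [DecidableEq V] (u v : V)
    (x : V → ℝ) : x ⬝ᵥ (edgeLap u v *ᵥ x) = (x u - x v) ^ 2 := by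
  have h : (fun w => (if w = u then (1 : ℝ) else 0) - (if w = v then (1 : ℝ) else 0)) ⬝ᵥ x =
      x u - x v := by
    simp [dotProduct, sub_mul, Finset.sum_sub_distrib]
  rw [edgeLap, vecMulVec_mulVec, dotProduct_smul, dotProduct_comm x, h]
  simp [sq]

theorem isHermitian_sum {ι n : Type*} (s : Finset ι) {A : ι → Matrix n n ℝ}
    (hA : ∀ i ∈ s, (A i).IsHermitian) : (∑ i ∈ s, A i).IsHermitian :=
  isSelfAdjoint_sum s hA

theorem card_sigma_ne {α κ : Type*} [Fintype α] [Fintype κ] [DecidableEq κ] (y : α → κ) :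
    Fintype.card (Σ v : α, {k : κ // y v ≠ k}) = Fintype.card α * (Fintype.card κ - 1) := by
  have h (v : α) : Fintype.card {k : κ // y v ≠ k} = Fintype.card κ - 1 := by
    simp_rw [ne_comm (a := y v)]
    simp
  simp [Fintype.card_sigma, h]

theorem card_sigma_lt (K : ℕ) :
    Fintype.card (Σ k : Fin K, {k' : Fin K // k < k'}) = K * (K - 1) / 2 := by
  have h (k : Fin K) : Fintype.card {k' : Fin K // k < k'} = K - 1 - k := by
    rw [Fintype.card_subtype, ← Fin.card_Ioi]
    congr 1
    ext
    simp
  simp_rw [Fintype.card_sigma, h]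
  rw [Fin.sum_univ_eq_sum_range (fun i => K - 1 - i), Finset.sum_range_reflect (fun i => i),
    Finset.sum_range_id]

/-- Theorem 1: the signed Laplacian of the collapsing-node augmented graph is
symmetric and has at most `K(K−1)/2 + K(|T| − 1)` negative eigenvalues
(counted with multiplicity). -/
theorem stmt_11 (N K : ℕ) (hN : 0 < N) (hK : 0 < K)
    (T : Finset (Fin N)) (hT : T.Nonempty)
    (y : {v // v ∈ T} → Fin K) (hy : Function.Surjective y)
    (E₀ : Finset (Fin N × Fin N)) (hE₀ : ∀ p ∈ E₀, p.1 ≠ p.2)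
    (Lc : Matrix (Fin N ⊕ Fin K) (Fin N ⊕ Fin K) ℝ)
    (hLc : Lc =
      (∑ p ∈ E₀, edgeLap (Sum.inl p.1) (Sum.inl p.2))
      + (∑ v ∈ T.attach, ∑ k : Fin K,
          (if y v = k then (1 : ℝ) else -1) • edgeLap (Sum.inl v.1) (Sum.inr k))
      + (∑ k : Fin K, ∑ k' ∈ Finset.univ.filter (fun k' => k < k'),
          (-1 : ℝ) • edgeLap (Sum.inr k) (Sum.inr k'))) :
    Lc.IsHermitian ∧
      ∀ hL : Lc.IsHermitian,
        (Finset.univ.filter (fun i => hL.eigenvalues i < 0)).card ≤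
          K * (K - 1) / 2 + K * (T.card - 1) := by
  have hLc_symm : Lc.IsHermitian := by
    rw [hLc]
    have hsmul (w : ℝ) (a b : Fin N ⊕ Fin K) : (w • edgeLap a b).IsHermitian :=
      (edgeLap_isHermitian a b).smul (IsSelfAdjoint.all w)
    exact ((isHermitian_sum _ fun _ _ => edgeLap_isHermitian _ _).add
      (isHermitian_sum _ fun _ _ => isHermitian_sum _ fun _ _ => hsmul _ _ _)).add
      (isHermitian_sum _ fun _ _ => isHermitian_sum _ fun _ _ => hsmul _ _ _)
  refine ⟨hLc_symm, fun hL => ?_⟩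
  let negativeEdges := (Σ v : {v // v ∈ T}, {k : Fin K // y v ≠ k}) ⊕
    (Σ k : Fin K, {k' : Fin K // k < k'})
  let d (a b : Fin N ⊕ Fin K) : (Fin N ⊕ Fin K → ℝ) →ₗ[ℝ] ℝ :=
    LinearMap.proj (R := ℝ) (φ := fun _ => ℝ) a - LinearMap.proj (R := ℝ) (φ := fun _ => ℝ) b
  let l : (Fin N ⊕ Fin K → ℝ) →ₗ[ℝ] (negativeEdges → ℝ) :=
    LinearMap.pi (Sum.elim (fun p => d (Sum.inl p.1.1) (Sum.inr p.2.1))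
      (fun p => d (Sum.inr p.1) (Sum.inr p.2.1)))
  have hcard := card_neg_eigenvalues_le hL l fun x hx => by
    have hlabel (v : {v // v ∈ T}) (k : Fin K) (h : y v ≠ k) :
        x (Sum.inl v.1) - x (Sum.inr k) = 0 :=
      congrFun hx (Sum.inl ⟨v, k, h⟩)
    have hclass (k k' : Fin K) (h : k < k') : x (Sum.inr k) - x (Sum.inr k') = 0 :=
      congrFun hx (Sum.inr ⟨k, k', h⟩)
    rw [hLc]
    simp only [add_mulVec, dotProduct_add, sum_mulVec, dotProduct_sum, smul_mulVec,
      dotProduct_smul, dotProduct_edgeLap_mulVec, smul_eq_mul]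
    refine add_nonneg (add_nonneg (Finset.sum_nonneg fun _ _ => sq_nonneg _)
      (Finset.sum_nonneg fun v _ => Finset.sum_nonneg fun k _ => ?_))
      (Finset.sum_nonneg fun k _ => Finset.sum_nonneg fun k' hk' => ?_)
    · split_ifs with h
      · rw [one_mul]
        exact sq_nonneg _
      · simp [hlabel v k h]
    · simp [hclass k k' (Finset.mem_filter.1 hk').2]
  rw [Fintype.card_sum, card_sigma_ne, card_sigma_lt, Fintype.card_coe, Fintype.card_fin] at hcard
  have hKT : K ≤ T.card := by simpa using Fintype.card_le_of_surjective y hy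
  have : T.card * (K - 1) ≤ K * (T.card - 1) := by
    rw [Nat.mul_sub_one, Nat.mul_sub_one, mul_comm]
    exact Nat.sub_le_sub_left hKT _
  omega
end

section
/- Let A be a symmetric n×n real matrix and let h : ℝ → ℝⁿ be differentiable with h'(t) = −(I − A) h(t) for all t. Then the energy t ↦ h(t) ⬝ (I − A) h(t) is nonincreasing: for all s ≤ t, h(t) ⬝ (I − A) h(t) ≤ h(s) ⬝ (I − A) h(s). -/
open Matrix

lemma HasDerivAt.dotProduct_pi {ι : Type*} [Fintype ι] {u v : ℝ → ι → ℝ} {u' v' : ι → ℝ} {t : ℝ}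
    (hu : HasDerivAt u u' t) (hv : HasDerivAt v v' t) :
    HasDerivAt (fun x => u x ⬝ᵥ v x) (u' ⬝ᵥ v t + u t ⬝ᵥ v') t := by
  simp only [dotProduct, ← Finset.sum_add_distrib]
  exact HasDerivAt.fun_sum fun i _ => (hasDerivAt_pi.1 hu i).mul (hasDerivAt_pi.1 hv i)

lemma HasDerivAt.const_mulVec_pi {ι κ : Type*} [Fintype ι] [Fintype κ] (M : Matrix κ ι ℝ)
    {u : ℝ → ι → ℝ} {u' : ι → ℝ} {t : ℝ} (hu : HasDerivAt u u' t) :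
    HasDerivAt (fun x => M *ᵥ u x) (M *ᵥ u') t :=
  (M.mulVecLin.toContinuousLinearMap.hasFDerivAt).comp_hasDerivAt t hu

lemma Matrix.IsSymm.antitone_dotProduct_mulVec_of_hasDerivAt {ι : Type*} [Fintype ι]
    {M : Matrix ι ι ℝ} (hM : M.IsSymm) {u : ℝ → ι → ℝ}
    (hu : ∀ t, HasDerivAt u (-(M *ᵥ u t)) t) :
    Antitone fun t => u t ⬝ᵥ M *ᵥ u t := by
  refine antitone_of_hasDerivAt_nonpos
    (fun t => (hu t).dotProduct_pi ((hu t).const_mulVec_pi M)) fun t => ?_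
  have hsymm : u t ⬝ᵥ M *ᵥ (M *ᵥ u t) = M *ᵥ u t ⬝ᵥ M *ᵥ u t := by
    rw [dotProduct_mulVec, ← mulVec_transpose, hM.eq]
  have hnonneg : 0 ≤ M *ᵥ u t ⬝ᵥ M *ᵥ u t := Finset.sum_nonneg fun i _ => mul_self_nonneg _
  simp only [mulVec_neg, neg_dotProduct, dotProduct_neg, hsymm, Pi.zero_apply]
  linarith

/-- Along the gradient flow `h' = −(I − A)h` for symmetric `A`, the energy
`h ⬝ (I − A) h` is nonincreasing. -/
theorem stmt_13 (n : ℕ) (A : Matrix (Fin n) (Fin n) ℝ) (hA : A.IsSymm)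
    (h : ℝ → Fin n → ℝ)
    (hode : ∀ t : ℝ, HasDerivAt h (-(((1 : Matrix (Fin n) (Fin n) ℝ) - A).mulVec (h t))) t) :
    ∀ s t : ℝ, s ≤ t →
      h t ⬝ᵥ ((1 : Matrix (Fin n) (Fin n) ℝ) - A).mulVec (h t) ≤
        h s ⬝ᵥ ((1 : Matrix (Fin n) (Fin n) ℝ) - A).mulVec (h s) := by
  intro s t hst
  exact (isSymm_one.sub hA).antitone_dotProduct_mulVec_of_hasDerivAt hode hst
end
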